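/- arXiv:2506.22317 — 2 statements merged into one kernel-verified Lean document; each statement's English description precedes it below -/
import Mathlib

section
/- The average size of a maximal independent set in the grid graph G_{2×n} satisfies A(G_{2×n}) = (φ/√5)·n + 2/5 + o(1); that is, lim_{n→∞} ( A(G_{2×n}) − (φ/√5)·n ) = 2/5, where φ = (1+√5)/2. -/
open SimpleGraph Finset

/-- A maximal independent set of a simple graph, as a `Finset` of vertices. -/
def IsMaxIndep {V : Type*} (G : SimpleGraph V) (s : Finset V) : Prop :=
  (∀ ⦃u⦄, u ∈ s → ∀ ⦃v⦄, v ∈ s → ¬ G.Adj u v) ∧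
  ∀ t : Finset V, (∀ ⦃u⦄, u ∈ t → ∀ ⦃v⦄, v ∈ t → ¬ G.Adj u v) → s ⊆ t → s = t

/-- The finite set of all maximal independent sets of `G`. -/
noncomputable def misFinset {V : Type*} [Fintype V] (G : SimpleGraph V) : Finset (Finset V) := by
  classical exact Finset.univ.filter (IsMaxIndep G)

/-- The number of orbits of maximal independent sets of `G` under the action of the
automorphism group of `G`. -/
noncomputable def nimisCard {V : Type*} [Fintype V] [DecidableEq V] (G : SimpleGraph V) : ℕ :=
  Nat.card (Quot (fun M N : {s : Finset V // IsMaxIndep G s} =>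
    ∃ e : G ≃g G, (M : Finset V).image e = (N : Finset V)))

/-- The grid graph `G_{m×n}`, the box product of two path graphs. -/
def gridGraph (m n : ℕ) : SimpleGraph (Fin m × Fin n) := pathGraph m □ pathGraph n

/-- The average size of a maximal independent set of `G`. -/
noncomputable def avgMIS {V : Type*} [Fintype V] (G : SimpleGraph V) : ℝ :=
  (∑ M ∈ misFinset G, (M.card : ℝ)) / ((misFinset G).card : ℝ)

/-- Independent domination characterises maximal independent sets. -/
theorem isMaxIndep_iff_dominating {V : Type*} (G : SimpleGraph V) (s : Finset V) :
    IsMaxIndep G s ↔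
      (∀ ⦃u⦄, u ∈ s → ∀ ⦃v⦄, v ∈ s → ¬ G.Adj u v) ∧ ∀ v, v ∉ s → ∃ u ∈ s, G.Adj u v := by
  classical
  constructor
  · rintro ⟨hs, hmax⟩
    refine ⟨hs, fun v hv => ?_⟩
    by_contra! hcon
    have h := hmax (insert v s) ?_ (Finset.subset_insert v s)
    · exact hv (h ▸ Finset.mem_insert_self v s)
    · intro x hx y hy hxy
      rcases Finset.mem_insert.1 hx with rfl | hx' <;>
        rcases Finset.mem_insert.1 hy with rfl | hy'
      · exact G.irrefl hxy
      · exact hcon _ hy' hxy.symm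
      · exact hcon _ hx' hxy
      · exact hs hx' hy' hxy
  · rintro ⟨hs, hdom⟩
    refine ⟨hs, fun t ht hst => Finset.Subset.antisymm hst fun v hv => ?_⟩
    by_contra hvs
    obtain ⟨u, hu, huv⟩ := hdom v hvs
    exact ht (hst hu) hv huv

/-- `A` and `B` are the two rows of a maximal independent set of the ladder with `n` rungs. -/
structure IsLadderMIS (n : ℕ) (A B : Finset ℕ) : Prop where
  lt_left : ∀ k ∈ A, k < n
  lt_right : ∀ k ∈ B, k < n
  disj : ∀ k ∈ A, k ∉ B
  indep_left : ∀ k ∈ A, k + 1 ∉ A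
  indep_right : ∀ k ∈ B, k + 1 ∉ B
  dom_left : ∀ k < n, k ∉ A → k ∈ B ∨ k + 1 ∈ A ∨ 1 ≤ k ∧ k - 1 ∈ A
  dom_right : ∀ k < n, k ∉ B → k ∈ A ∨ k + 1 ∈ B ∨ 1 ≤ k ∧ k - 1 ∈ B

theorem IsLadderMIS.swap {n : ℕ} {A B : Finset ℕ} (h : IsLadderMIS n A B) :
    IsLadderMIS n B A :=
  ⟨h.lt_right, h.lt_left, fun k hB hA => h.disj k hA hB, h.indep_right, h.indep_left,
    h.dom_right, h.dom_left⟩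

/-- The last rung is occupied. -/
theorem IsLadderMIS.last_mem {n : ℕ} {A B : Finset ℕ} (h : IsLadderMIS (n + 1) A B) :
    n ∈ A ∨ n ∈ B := by
  obtain ⟨h1, h2, h3, h4, h5, h6, h7⟩ := h
  by_contra! hcon
  have hA := h6 n (by omega) hcon.1
  have hB := h7 n (by omega) hcon.2
  have hA' : n + 1 ∉ A := fun h => by have := h1 _ h; omega
  have hB' : n + 1 ∉ B := fun h => by have := h2 _ h; omega
  simp only [hcon, hA', hB', false_or] at hA hB
  exact h3 _ hA.2 hB.2

/-- The maximal independent sets of the ladder with `n` rungs, as pairs of rows, whose last rung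
is occupied in the first row. -/
def ladderSets : ℕ → Finset (Finset ℕ × Finset ℕ)
  | 0 => ∅
  | 1 => {({0}, ∅)}
  | n + 2 => (ladderSets (n + 1) ∪ ladderSets n).image fun p => (insert (n + 1) p.2, p.1)

theorem isLadderMIS_one_iff {A B : Finset ℕ} :
    IsLadderMIS 1 A B ∧ 0 ∈ A ↔ A = {0} ∧ B = ∅ := by
  constructor
  · rintro ⟨⟨h1, h2, h3, -⟩, h0⟩
    constructor
    · ext k
      simp only [Finset.mem_singleton]
      constructor
      · intro hk; have := h1 k hk; omega
      · rintro rfl; exact h0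
    · rw [Finset.eq_empty_iff_forall_notMem]
      intro k hk
      have := h2 k hk
      obtain rfl : k = 0 := by omega
      exact h3 _ h0 hk
  · rintro ⟨rfl, rfl⟩
    exact ⟨by constructor <;> simp, by simp⟩

theorem IsLadderMIS.insert_succ {n : ℕ} {A B : Finset ℕ} (h : IsLadderMIS (n + 1) A B)
    (hn : n ∈ A) : IsLadderMIS (n + 2) (insert (n + 1) B) A := by
  obtain ⟨h1, h2, h3, h4, h5, h6, h7⟩ := h
  constructor
  case dom_left => intro k; have hk6 := h6 k; have hk7 := h7 k; clear h6 h7; grind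
  case dom_right => intro k; have hk6 := h6 k; have hk7 := h7 k; clear h6 h7; grind
  all_goals clear h6 h7; grind

theorem IsLadderMIS.insert_succ_succ {n : ℕ} {A B : Finset ℕ} (h : IsLadderMIS (n + 1) A B)
    (hn : n ∈ A) : IsLadderMIS (n + 3) (insert (n + 2) B) A := by
  obtain ⟨h1, h2, h3, h4, h5, h6, h7⟩ := h
  constructor
  case dom_left => intro k; have hk6 := h6 k; have hk7 := h7 k; clear h6 h7; grind
  case dom_right => intro k; have hk6 := h6 k; have hk7 := h7 k; clear h6 h7; grind
  all_goals clear h6 h7; grind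

theorem IsLadderMIS.erase_succ {n : ℕ} {A B : Finset ℕ} (h : IsLadderMIS (n + 2) A B)
    (hn : n + 1 ∈ A) (hB : n ∈ B) : IsLadderMIS (n + 1) B (A.erase (n + 1)) := by
  obtain ⟨h1, h2, h3, h4, h5, h6, h7⟩ := h
  constructor
  case dom_left => intro k; have hk6 := h6 k; have hk7 := h7 k; clear h6 h7; grind
  case dom_right => intro k; have hk6 := h6 k; have hk7 := h7 k; clear h6 h7; grind
  all_goals clear h6 h7; grind

theorem IsLadderMIS.exists_of_notMem {n : ℕ} {A B : Finset ℕ} (h : IsLadderMIS (n + 2) A B)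
    (hn : n + 1 ∈ A) (hB : n ∉ B) :
    ∃ m, n = m + 1 ∧ m ∈ B ∧ IsLadderMIS n B (A.erase (n + 1)) := by
  obtain ⟨h1, h2, h3, h4, h5, h6, h7⟩ := h
  have hA : n ∉ A := fun h => h4 n h hn
  have hB' : n + 1 ∉ B := h3 _ hn
  have := h7 n (by omega) hB
  simp only [hA, hB', false_or] at this
  obtain ⟨hn0, hm⟩ := this
  obtain ⟨m, rfl⟩ := Nat.exists_eq_add_of_le' hn0
  rw [Nat.add_sub_cancel] at hm
  refine ⟨m, rfl, hm, ?_⟩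
  constructor
  case dom_left => intro k; have hk6 := h6 k; have hk7 := h7 k; clear h6 h7; grind
  case dom_right => intro k; have hk6 := h6 k; have hk7 := h7 k; clear h6 h7; grind
  all_goals clear h6 h7; grind

theorem mem_ladderSets_succ (n : ℕ) (A B : Finset ℕ) :
    (A, B) ∈ ladderSets (n + 1) ↔ IsLadderMIS (n + 1) A B ∧ n ∈ A := by
  induction n using Nat.strong_induction_on generalizing A B with
  | _ n ih =>
    rcases n with _ | n
    · simp [ladderSets, isLadderMIS_one_iff]
    · simp only [ladderSets, Finset.mem_image, Finset.mem_union, Prod.exists, Prod.mk.injEq]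
      constructor
      · rintro ⟨C, D, h | h, rfl, rfl⟩
        · rw [ih n (by omega)] at h
          exact ⟨h.1.insert_succ h.2, Finset.mem_insert_self _ _⟩
        · rcases n with _ | n
          · simp [ladderSets] at h
          · rw [ih n (by omega)] at h
            exact ⟨h.1.insert_succ_succ h.2, Finset.mem_insert_self _ _⟩
      · rintro ⟨h, hn⟩
        refine ⟨B, A.erase (n + 1), ?_, Finset.insert_erase hn, rfl⟩
        by_cases hB : n ∈ B
        · left
          rw [ih n (by omega)]
          exact ⟨h.erase_succ hn hB, hB⟩
        · right
          obtain ⟨m, rfl, hm, h'⟩ := h.exists_of_notMem hn hB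
          rw [ih m (by omega)]
          exact ⟨h', hm⟩

theorem lt_of_mem_ladderSets {n : ℕ} {p : Finset ℕ × Finset ℕ} (hp : p ∈ ladderSets n) :
    (∀ k ∈ p.1, k < n) ∧ ∀ k ∈ p.2, k < n := by
  rcases n with _ | n
  · simp [ladderSets] at hp
  · have := ((mem_ladderSets_succ n p.1 p.2).1 hp).1
    exact ⟨this.lt_left, this.lt_right⟩

theorem sum_ladderSets_add_two (f : ℕ → ℝ) (n : ℕ) :
    ∑ p ∈ ladderSets (n + 2), f (p.1.card + p.2.card) =
      ∑ p ∈ ladderSets (n + 1), f (p.1.card + p.2.card + 1) +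
        ∑ p ∈ ladderSets n, f (p.1.card + p.2.card + 1) := by
  have hlt : ∀ p ∈ ladderSets (n + 1) ∪ ladderSets n, n + 1 ∉ p.2 := by
    intro p hp hmem
    rcases Finset.mem_union.1 hp with h | h
    · have := (lt_of_mem_ladderSets h).2 _ hmem; omega
    · have := (lt_of_mem_ladderSets h).2 _ hmem; omega
  have hdisj : Disjoint (ladderSets (n + 1)) (ladderSets n) := by
    rw [Finset.disjoint_left]
    rintro ⟨A, B⟩ h h'
    have := (lt_of_mem_ladderSets h').1 n ((mem_ladderSets_succ n A B).1 h).2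
    omega
  rw [ladderSets, Finset.sum_image, Finset.sum_congr rfl, Finset.sum_union hdisj]
  · intro p hp
    rw [Finset.card_insert_of_notMem (hlt p hp)]
    rw [add_comm p.1.card, add_right_comm]
  · rintro ⟨A, B⟩ hp ⟨C, D⟩ hq h
    simp only [Prod.mk.injEq] at h ⊢
    refine ⟨h.2, ?_⟩
    have hB : n + 1 ∉ B := hlt _ hp
    have hD : n + 1 ∉ D := hlt _ hq
    rw [← Finset.erase_insert hB, ← Finset.erase_insert hD, h.1]

theorem sum_one_ladderSets (n : ℕ) : ∑ _p ∈ ladderSets n, (1 : ℝ) = Nat.fib n := by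
  induction n using Nat.twoStepInduction with
  | zero => simp [ladderSets]
  | one => simp [ladderSets]
  | more n h0 h1 =>
    rw [sum_ladderSets_add_two (fun _ => 1), h0, h1, Nat.fib_add_two]
    push_cast
    ring

theorem sum_card_ladderSets (n : ℕ) :
    ∑ p ∈ ladderSets n, ((p.1.card + p.2.card : ℕ) : ℝ) =
      (n * (2 * Nat.fib n + Nat.fib (n + 1)) + 2 * Nat.fib n) / 5 := by
  induction n using Nat.twoStepInduction with
  | zero => simp [ladderSets]
  | one => norm_num [ladderSets]
  | more n h0 h1 =>
    rw [sum_ladderSets_add_two (fun m => (m : ℝ))]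
    simp only [Nat.cast_add_one]
    rw [Finset.sum_add_distrib, Finset.sum_add_distrib, h0, h1, sum_one_ladderSets,
      sum_one_ladderSets]
    simp only [Nat.fib_add_two]
    push_cast
    ring

/-- The rows of a set of vertices of the grid with two rows. -/
def gridRow {n : ℕ} (M : Finset (Fin 2 × Fin n)) (i : Fin 2) : Finset ℕ :=
  (Finset.univ.filter fun j => (i, j) ∈ M).map Fin.valEmbedding

theorem mem_gridRow {n : ℕ} (M : Finset (Fin 2 × Fin n)) (i : Fin 2) (k : ℕ) :
    k ∈ gridRow M i ↔ ∃ h : k < n, (i, ⟨k, h⟩) ∈ M := by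
  simp only [gridRow, Finset.mem_map, Finset.mem_filter, Finset.mem_univ, true_and,
    Fin.valEmbedding_apply]
  constructor
  · rintro ⟨j, hj, rfl⟩; exact ⟨j.2, hj⟩
  · rintro ⟨h, hk⟩; exact ⟨_, hk, rfl⟩

theorem val_mem_gridRow {n : ℕ} (M : Finset (Fin 2 × Fin n)) (i : Fin 2) (j : Fin n) :
    (j : ℕ) ∈ gridRow M i ↔ (i, j) ∈ M := by
  simp [mem_gridRow]

theorem card_gridRow_add {n : ℕ} (M : Finset (Fin 2 × Fin n)) :
    (gridRow M 0).card + (gridRow M 1).card = M.card := by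
  have h := Finset.card_eq_sum_card_fiberwise (s := M) (t := Finset.univ) (f := Prod.fst)
    (fun _ _ => Finset.mem_coe.2 (Finset.mem_univ _))
  rw [h, Fin.sum_univ_two]
  have hrow : ∀ i : Fin 2, (gridRow M i).card = (M.filter fun p => p.1 = i).card := by
    intro i
    rw [gridRow, Finset.card_map]
    refine Finset.card_bij (fun j _ => (i, j)) ?_ ?_ ?_
    · intro j hj; simpa using hj
    · intro j _ k _ h; simpa using h
    · rintro ⟨i', j⟩ hb
      simp only [Finset.mem_filter] at hb
      obtain ⟨hb, rfl⟩ := hb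
      exact ⟨j, by simpa using hb, rfl⟩
  rw [hrow, hrow]

/-- The set of vertices of the grid with two rows with prescribed rows. -/
def ofGridRows (n : ℕ) (A B : Finset ℕ) : Finset (Fin 2 × Fin n) :=
  Finset.univ.filter fun p => (p.1 = 0 ∧ (p.2 : ℕ) ∈ A) ∨ (p.1 = 1 ∧ (p.2 : ℕ) ∈ B)

theorem gridRow_ofGridRows_zero {n : ℕ} {A : Finset ℕ} (B : Finset ℕ) (hA : ∀ k ∈ A, k < n) :
    gridRow (ofGridRows n A B) 0 = A := by
  ext k
  simpa [mem_gridRow, ofGridRows] using hA k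

theorem gridRow_ofGridRows_one {n : ℕ} (A : Finset ℕ) {B : Finset ℕ} (hB : ∀ k ∈ B, k < n) :
    gridRow (ofGridRows n A B) 1 = B := by
  ext k
  simpa [mem_gridRow, ofGridRows] using hB k

theorem ofGridRows_gridRow {n : ℕ} (M : Finset (Fin 2 × Fin n)) :
    ofGridRows n (gridRow M 0) (gridRow M 1) = M := by
  ext ⟨i, j⟩
  simp only [ofGridRows, Finset.mem_filter, Finset.mem_univ, true_and, val_mem_gridRow]
  fin_cases i <;> simp

theorem gridGraph_two_adj {n : ℕ} (i i' : Fin 2) (j j' : Fin n) :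
    (gridGraph 2 n).Adj (i, j) (i', j') ↔
      (i ≠ i' ∧ j = j') ∨ (i = i' ∧ ((j : ℕ) + 1 = j' ∨ (j' : ℕ) + 1 = j)) := by
  simp only [gridGraph, boxProd_adj, pathGraph_adj]
  constructor
  · rintro (⟨h, h'⟩ | ⟨h, h'⟩)
    · exact Or.inl ⟨by rintro rfl; omega, h'⟩
    · exact Or.inr ⟨h', h⟩
  · rintro (⟨h, h'⟩ | ⟨h, h'⟩)
    · exact Or.inl ⟨by omega, h'⟩
    · exact Or.inr ⟨h', h⟩

theorem isMaxIndep_gridGraph_two_iff {n : ℕ} (M : Finset (Fin 2 × Fin n)) :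
    IsMaxIndep (gridGraph 2 n) M ↔ IsLadderMIS n (gridRow M 0) (gridRow M 1) := by
  rw [isMaxIndep_iff_dominating]
  constructor
  · rintro ⟨hs, hd⟩
    have hdom : ∀ i i' : Fin 2, i ≠ i' → ∀ k < n, k ∉ gridRow M i → k ∈ gridRow M i' ∨
        k + 1 ∈ gridRow M i ∨ 1 ≤ k ∧ k - 1 ∈ gridRow M i := by
      intro i i' hi k hk hkM
      obtain ⟨⟨l, j⟩, hlj, hadj⟩ := hd (i, ⟨k, hk⟩) fun h => hkM ((mem_gridRow ..).2 ⟨hk, h⟩)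
      have hmem := (val_mem_gridRow ..).2 hlj
      rw [gridGraph_two_adj] at hadj
      rcases hadj with ⟨h, rfl⟩ | ⟨rfl, h | h⟩
      · obtain rfl : l = i' := by omega
        exact Or.inl hmem
      · obtain rfl : (j : ℕ) + 1 = k := h
        exact Or.inr (Or.inr ⟨by omega, hmem⟩)
      · obtain h : k + 1 = j := h
        exact Or.inr (Or.inl (h ▸ hmem))
    have hindep : ∀ i : Fin 2, ∀ k ∈ gridRow M i, k + 1 ∉ gridRow M i := by
      intro i k h h'
      obtain ⟨_, h⟩ := (mem_gridRow ..).1 h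
      obtain ⟨_, h'⟩ := (mem_gridRow ..).1 h'
      exact hs h h' ((gridGraph_two_adj ..).2 (Or.inr ⟨rfl, Or.inl rfl⟩))
    refine ⟨fun k h => ((mem_gridRow ..).1 h).1, fun k h => ((mem_gridRow ..).1 h).1, ?_,
      hindep 0, hindep 1, hdom 0 1 (by decide), hdom 1 0 (by decide)⟩
    intro k h h'
    obtain ⟨_, h⟩ := (mem_gridRow ..).1 h
    obtain ⟨_, h'⟩ := (mem_gridRow ..).1 h'
    exact hs h h' ((gridGraph_two_adj ..).2 (Or.inl ⟨by decide, rfl⟩))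
  · intro h
    have hdom : ∀ i i' : Fin 2, i' ≠ i → ∀ k < n, k ∉ gridRow M i → k ∈ gridRow M i' ∨
        k + 1 ∈ gridRow M i ∨ 1 ≤ k ∧ k - 1 ∈ gridRow M i := by
      intro i i' hi
      fin_cases i <;> fin_cases i'
      · exact absurd rfl hi
      · exact h.dom_left
      · exact h.dom_right
      · exact absurd rfl hi
    have hindep : ∀ i : Fin 2, ∀ k ∈ gridRow M i, k + 1 ∉ gridRow M i := by
      intro i
      fin_cases i
      · exact h.indep_left
      · exact h.indep_right
    have hdisj : ∀ i i' : Fin 2, i ≠ i' → ∀ k ∈ gridRow M i, k ∉ gridRow M i' := by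
      intro i i' hi
      fin_cases i <;> fin_cases i'
      · exact absurd rfl hi
      · exact h.disj
      · exact h.swap.disj
      · exact absurd rfl hi
    constructor
    · rintro ⟨i, j⟩ hu ⟨i', j'⟩ hv hadj
      rw [← val_mem_gridRow] at hu hv
      rw [gridGraph_two_adj] at hadj
      rcases hadj with ⟨hi, rfl⟩ | ⟨rfl, hj | hj⟩
      · exact hdisj _ _ hi _ hu hv
      · exact hindep _ _ hu (hj ▸ hv)
      · exact hindep _ _ hv (hj ▸ hu)
    · rintro ⟨i, j⟩ hv
      rw [← val_mem_gridRow] at hv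
      have hi : i + 1 ≠ i := by omega
      rcases hdom i (i + 1) hi j j.2 hv with h | h | ⟨hj, h⟩
      · exact ⟨(i + 1, j), (val_mem_gridRow ..).1 h, (gridGraph_two_adj ..).2 (Or.inl ⟨hi, rfl⟩)⟩
      · obtain ⟨hlt, h⟩ := (mem_gridRow ..).1 h
        exact ⟨_, h, (gridGraph_two_adj ..).2 (Or.inr ⟨rfl, Or.inr rfl⟩)⟩
      · obtain ⟨hlt, h⟩ := (mem_gridRow ..).1 h
        exact ⟨_, h, (gridGraph_two_adj ..).2 (Or.inr ⟨rfl, Or.inl (Nat.sub_add_cancel hj)⟩)⟩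

/-- Sums over the maximal independent sets of the grid with two rows of a function of the size. -/
theorem sum_misFinset_gridGraph_two (f : ℕ → ℝ) (n : ℕ) :
    ∑ M ∈ misFinset (gridGraph 2 (n + 1)), f M.card =
      2 * ∑ p ∈ ladderSets (n + 1), f (p.1.card + p.2.card) := by
  classical
  have hmem : ∀ p : Finset ℕ × Finset ℕ,
      p ∈ ladderSets (n + 1) ∪ (ladderSets (n + 1)).image Prod.swap ↔
        IsLadderMIS (n + 1) p.1 p.2 := by
    rintro ⟨A, B⟩
    have hswap : (A, B) ∈ (ladderSets (n + 1)).image Prod.swap ↔ (B, A) ∈ ladderSets (n + 1) := by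
      simp
    rw [Finset.mem_union, hswap, mem_ladderSets_succ, mem_ladderSets_succ]
    constructor
    · rintro (h | h)
      · exact h.1
      · exact h.1.swap
    · intro h
      rcases h.last_mem with h' | h'
      · exact Or.inl ⟨h, h'⟩
      · exact Or.inr ⟨h.swap, h'⟩
  have hdisj : Disjoint (ladderSets (n + 1)) ((ladderSets (n + 1)).image Prod.swap) := by
    rw [Finset.disjoint_left]
    rintro ⟨A, B⟩ h h'
    have h'' : (B, A) ∈ ladderSets (n + 1) := by simpa using h'
    rw [mem_ladderSets_succ] at h h''
    exact h.1.disj _ h.2 h''.2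
  have hsum : ∑ M ∈ misFinset (gridGraph 2 (n + 1)), f M.card =
      ∑ p ∈ ladderSets (n + 1) ∪ (ladderSets (n + 1)).image Prod.swap,
        f (p.1.card + p.2.card) := by
    refine Finset.sum_bij' (fun M _ => (gridRow M 0, gridRow M 1))
      (fun p _ => ofGridRows (n + 1) p.1 p.2) ?_ ?_ ?_ ?_ ?_
    · intro M hM
      rw [hmem]
      simpa [misFinset, isMaxIndep_gridGraph_two_iff] using hM
    · intro p hp
      rw [hmem] at hp
      simpa [misFinset, isMaxIndep_gridGraph_two_iff, gridRow_ofGridRows_zero _ hp.lt_left,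
        gridRow_ofGridRows_one _ hp.lt_right] using hp
    · intro M _
      exact ofGridRows_gridRow M
    · intro p hp
      rw [hmem] at hp
      exact Prod.ext (gridRow_ofGridRows_zero _ hp.lt_left) (gridRow_ofGridRows_one _ hp.lt_right)
    · intro M _
      simp only [card_gridRow_add]
  rw [hsum, Finset.sum_union hdisj, Finset.sum_image Prod.swap_injective.injOn, two_mul]
  simp only [Prod.fst_swap, Prod.snd_swap, add_comm]

theorem avgMIS_gridGraph_two (n : ℕ) :
    avgMIS (gridGraph 2 (n + 1)) = (∑ p ∈ ladderSets (n + 1), ((p.1.card + p.2.card : ℕ) : ℝ)) /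
      Nat.fib (n + 1) := by
  rw [avgMIS, sum_misFinset_gridGraph_two (fun m => (m : ℝ)), Finset.card_eq_sum_ones]
  push_cast
  rw [sum_misFinset_gridGraph_two (fun _ => 1), sum_one_ladderSets,
    mul_div_mul_left _ _ two_ne_zero]

/-- The exact deviation of the average size from its asymptotic value. -/
theorem avgMIS_gridGraph_two_sub (n : ℕ) :
    avgMIS (gridGraph 2 (n + 1)) -
        ((1 + Real.sqrt 5) / 2 / Real.sqrt 5) * ((n + 1 : ℕ) : ℝ) =
      2 / 5 + ((n + 1 : ℕ) : ℝ) * Real.goldenConj ^ (n + 1) / (5 * Nat.fib (n + 1)) := by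
  have hpos : (0 : ℝ) < Nat.fib (n + 1) := by exact_mod_cast Nat.fib_pos.2 n.succ_pos
  have h5 : Real.sqrt 5 * Real.sqrt 5 = 5 := Real.mul_self_sqrt (by norm_num)
  have h5' : Real.sqrt 5 ≠ 0 := by positivity
  have hkey : Real.goldenConj ^ (n + 1) =
      Nat.fib (n + 2) - Real.goldenRatio * Nat.fib (n + 1) :=
    (Real.fib_succ_sub_goldenRatio_mul_fib (n + 1)).symm
  have hconst : (1 + Real.sqrt 5) / 2 / Real.sqrt 5 = 2 / 5 + Real.goldenRatio / 5 := by
    rw [Real.goldenRatio]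
    field_simp
    linear_combination -h5
  rw [avgMIS_gridGraph_two, sum_card_ladderSets, hkey, hconst]
  field_simp
  ring

theorem avg_mis_grid_two_by_n :
    Filter.Tendsto
      (fun n : ℕ => avgMIS (gridGraph 2 n) - ((1 + Real.sqrt 5) / 2 / Real.sqrt 5) * n)
      Filter.atTop (nhds (2 / 5)) := by
  rw [← Filter.tendsto_add_atTop_iff_nat 1]
  simp only [avgMIS_gridGraph_two_sub]
  have habs : |Real.goldenConj| < 1 :=
    abs_lt.2 ⟨Real.neg_one_lt_goldenConj, Real.goldenConj_neg.trans one_pos⟩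
  have hlim : Filter.Tendsto (fun n : ℕ => ((n + 1 : ℕ) : ℝ) * Real.goldenConj ^ (n + 1))
      Filter.atTop (nhds 0) :=
    (tendsto_self_mul_const_pow_of_abs_lt_one habs).comp (Filter.tendsto_add_atTop_nat 1)
  have herr : Filter.Tendsto (fun n : ℕ => ((n + 1 : ℕ) : ℝ) * Real.goldenConj ^ (n + 1) /
      (5 * Nat.fib (n + 1))) Filter.atTop (nhds 0) := by
    refine squeeze_zero_norm (fun n => ?_) (tendsto_zero_iff_norm_tendsto_zero.1 hlim)
    have hfib : (1 : ℝ) ≤ Nat.fib (n + 1) := by exact_mod_cast Nat.fib_pos.2 n.succ_pos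
    rw [norm_div]
    refine div_le_self (norm_nonneg _) ?_
    rw [Real.norm_of_nonneg (by positivity)]
    linarith
  simpa using herr.const_add (2 / 5)
end

section
/- The average size of a maximal independent set in the fat grid cylinder B_{2×n} satisfies A(B_{2×n}) = (φ/√5)·n + o(1); that is, lim_{n→∞} ( A(B_{2×n}) − (φ/√5)·n ) = 0, where φ = (1+√5)/2. -/
open SimpleGraph Finset

/-- The fat grid cylinder `B_{m×n}`, the box product of a path graph and a cycle graph. -/
def fatCylinder (m n : ℕ) : SimpleGraph (Fin m × Fin n) := pathGraph m □ cycleGraph n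

/-- Column states of a maximal independent set read along the cycle: the row of the last chosen
vertex, together with a flag recording whether the current column is empty. -/
abbrev ColumnState := Fin 2 × Bool

/-- The admissible transitions between the states of consecutive columns. -/
def ColumnState.Step (s t : ColumnState) : Prop :=
  (s.2 = true → t.2 = false) ∧ (t.2 = true ↔ t.1 = s.1)

instance : DecidableRel ColumnState.Step := fun s t => by
  unfold ColumnState.Step; infer_instance

open Polynomial in
/-- The transfer matrix, in which every nonempty column has weight `X`. -/
noncomputable def columnTransfer : Matrix ColumnState ColumnState ℤ[X] :=
  fun s t => if s.Step t then (if s.2 = false then X else 1) else 0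

theorem sum_path_prod_eq_pow {σ R : Type*} [Fintype σ] [DecidableEq σ] [CommSemiring R]
    (A : Matrix σ σ R) (n : ℕ) (a b : σ) :
    ∑ f : Fin n → σ, ∏ i : Fin (n + 1),
      A ((Fin.cons a f : Fin (n + 1) → σ) i) ((Fin.snoc f b : Fin (n + 1) → σ) i) =
      (A ^ (n + 1)) a b := by
  induction n generalizing a with
  | zero => simp [Fin.snoc]
  | succ n ih =>
    rw [pow_succ', Matrix.mul_apply, ← (Fin.consEquiv fun _ => σ).sum_comp, Fintype.sum_prod_type]
    refine Finset.sum_congr rfl fun c _ => ?_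
    rw [← ih, Finset.mul_sum]
    refine Finset.sum_congr rfl fun g _ => ?_
    rw [Fin.prod_univ_succ]
    simp [Fin.consEquiv, ← Fin.cons_snoc_eq_snoc_cons]

theorem sum_cycle_prod_eq_trace_pow {σ R : Type*} [Fintype σ] [DecidableEq σ] [CommSemiring R]
    (A : Matrix σ σ R) (n : ℕ) :
    ∑ f : Fin (n + 1) → σ, ∏ i, A (f i) (f (i + 1)) = (A ^ (n + 1)).trace := by
  rw [Matrix.trace, ← (Fin.consEquiv fun _ => σ).sum_comp, Fintype.sum_prod_type]
  refine Finset.sum_congr rfl fun a _ => ?_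
  rw [Matrix.diag_apply, ← sum_path_prod_eq_pow]
  refine Finset.sum_congr rfl fun g _ => Finset.prod_congr rfl fun i _ => ?_
  congr 1
  refine Fin.lastCases ?_ (fun j => ?_) i
  · simp [Fin.consEquiv]
  · simp [Fin.consEquiv]

theorem isMaxIndep_iff {V : Type*} [DecidableEq V] (G : SimpleGraph V) (s : Finset V) :
    IsMaxIndep G s ↔ (∀ u ∈ s, ∀ v ∈ s, ¬ G.Adj u v) ∧ ∀ v, v ∉ s → ∃ u ∈ s, G.Adj u v := by
  refine ⟨fun ⟨h, hmax⟩ => ⟨h, fun v hv => ?_⟩, fun ⟨h, hdom⟩ => ⟨h, fun t ht hst => ?_⟩⟩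
  · by_contra! hn
    refine hv ((hmax (insert v s) ?_ (Finset.subset_insert v s)) ▸ Finset.mem_insert_self v s)
    intro u hu w hw
    rw [Finset.mem_insert] at hu hw
    rcases hu with rfl | hu <;> rcases hw with rfl | hw
    · exact G.irrefl
    · exact fun h' => hn w hw h'.symm
    · exact hn u hu
    · exact h hu hw
  · refine hst.antisymm fun v hv => ?_
    by_contra hvs
    obtain ⟨u, hu, huv⟩ := hdom v hvs
    exact ht (hst hu) hv huv

theorem fatCylinder_two_adj (n : ℕ) (u v : Fin 2 × Fin (n + 3)) :
    (fatCylinder 2 (n + 3)).Adj u v ↔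
      (u.1 ≠ v.1 ∧ u.2 = v.2) ∨ (u.1 = v.1 ∧ (v.2 = u.2 + 1 ∨ u.2 = v.2 + 1)) := by
  obtain ⟨a, i⟩ := u
  obtain ⟨b, j⟩ := v
  have hp : (pathGraph 2).Adj a b ↔ a ≠ b := by
    rw [pathGraph_two_eq_top, top_adj]
  have hc : (cycleGraph (n + 3)).Adj i j ↔ j = i + 1 ∨ i = j + 1 := by
    rw [cycleGraph_adj, sub_eq_iff_eq_add', sub_eq_iff_eq_add', or_comm, add_comm i, add_comm j]
  rw [fatCylinder, boxProd_adj, hp, hc]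
  tauto

theorem isMaxIndep_fatCylinder_two_iff (n : ℕ) (s : Finset (Fin 2 × Fin (n + 3))) :
    IsMaxIndep (fatCylinder 2 (n + 3)) s ↔
      (∀ i, ¬ ((0, i) ∈ s ∧ (1, i) ∈ s)) ∧
      (∀ r i, ¬ ((r, i) ∈ s ∧ (r, i + 1) ∈ s)) ∧
      ∀ r i, (0, i + 1) ∈ s ∨ (1, i + 1) ∈ s ∨ (r, i) ∈ s ∨ (r, i + 1 + 1) ∈ s := by
  rw [isMaxIndep_iff]
  constructor
  · rintro ⟨hind, hdom⟩
    refine ⟨fun i h => hind _ h.1 _ h.2 ?_, fun r i h => hind _ h.1 _ h.2 ?_, fun r i => ?_⟩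
    · simp [fatCylinder_two_adj]
    · simp [fatCylinder_two_adj]
    · by_contra! hn
      obtain ⟨⟨a, j⟩, hu, hadj⟩ := hdom (r, i + 1)
        (by fin_cases r; exacts [hn.1, hn.2.1])
      rw [fatCylinder_two_adj] at hadj
      simp only at hadj
      rcases hadj with ⟨-, rfl⟩ | ⟨rfl, h | rfl⟩
      · fin_cases a
        exacts [hn.1 hu, hn.2.1 hu]
      · rw [add_left_inj] at h
        exact hn.2.2.1 (h ▸ hu)
      · exact hn.2.2.2 hu
  · rintro ⟨hcol, hrow, hdom⟩
    refine ⟨?_, ?_⟩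
    · rintro ⟨a, i⟩ hu ⟨b, j⟩ hv hadj
      rw [fatCylinder_two_adj] at hadj
      simp only at hadj
      rcases hadj with ⟨hab, rfl⟩ | ⟨rfl, rfl | rfl⟩
      · fin_cases a <;> fin_cases b <;> simp at hab
        exacts [hcol _ ⟨hu, hv⟩, hcol _ ⟨hv, hu⟩]
      · exact hrow _ _ ⟨hu, hv⟩
      · exact hrow _ _ ⟨hv, hu⟩
    · rintro ⟨r, j⟩ hv
      obtain ⟨i, rfl⟩ : ∃ i, j = i + 1 := ⟨j - 1, by simp⟩
      simp only [fatCylinder_two_adj]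
      rcases hdom r i with h | h | h | h
      · refine ⟨_, h, Or.inl ⟨?_, rfl⟩⟩
        rintro rfl
        exact hv h
      · refine ⟨_, h, Or.inl ⟨?_, rfl⟩⟩
        rintro rfl
        exact hv h
      · exact ⟨_, h, by simp⟩
      · exact ⟨_, h, by simp⟩

/-- The vertex set selected by a sequence of column states. -/
def selectedVertices {n : ℕ} (f : Fin n → ColumnState) : Finset (Fin 2 × Fin n) :=
  {v | f v.2 = (v.1, false)}

theorem mem_selectedVertices {n : ℕ} (f : Fin n → ColumnState) (r : Fin 2) (i : Fin n) :
    (r, i) ∈ selectedVertices f ↔ f i = (r, false) := by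
  simp [selectedVertices]

theorem card_selectedVertices {n : ℕ} (f : Fin n → ColumnState) :
    (selectedVertices f).card = ({i | (f i).2 = false} : Finset (Fin n)).card := by
  refine Finset.card_nbij' (fun v => v.2) (fun i => ((f i).1, i)) ?_ ?_ ?_ ?_
  · rintro ⟨r, i⟩ h
    simp_all [selectedVertices]
  · intro i h
    simp_all [selectedVertices, Prod.ext_iff]
  · rintro ⟨r, i⟩ h
    simp_all [selectedVertices]
  · intro i h
    rfl

/-- The column states read off a vertex set. -/
def columnStates {n : ℕ} [NeZero n] (s : Finset (Fin 2 × Fin n)) (i : Fin n) : ColumnState :=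
  if (0, i) ∈ s then (0, false) else if (1, i) ∈ s then (1, false) else
    if (0, i - 1) ∈ s then (0, true) else (1, true)

theorem isMaxIndep_selectedVertices {n : ℕ} {f : Fin (n + 3) → ColumnState}
    (hf : ∀ i, (f i).Step (f (i + 1))) :
    IsMaxIndep (fatCylinder 2 (n + 3)) (selectedVertices f) := by
  rw [isMaxIndep_fatCylinder_two_iff]
  simp only [mem_selectedVertices]
  refine ⟨fun i => ?_, fun r i => ?_, fun r i => ?_⟩
  · rintro ⟨h, h'⟩
    simp [h] at h'
  · rintro ⟨h, h'⟩
    simpa [h, h', ColumnState.Step] using hf i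
  · have h₁ := hf i
    have h₂ := hf (i + 1)
    generalize f i = a at *
    generalize f (i + 1) = b at *
    generalize f (i + 1 + 1) = c at *
    revert r a b c
    decide

theorem step_columnStates {n : ℕ} {s : Finset (Fin 2 × Fin (n + 3))}
    (hs : IsMaxIndep (fatCylinder 2 (n + 3)) s) (i : Fin (n + 3)) :
    (columnStates s i).Step (columnStates s (i + 1)) := by
  obtain ⟨hcol, hrow, hdom⟩ := (isMaxIndep_fatCylinder_two_iff n s).1 hs
  obtain ⟨j, rfl⟩ : ∃ j, i = j + 1 := ⟨i - 1, by simp⟩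
  have h₁ := hcol j
  have h₂ := hcol (j + 1)
  have h₃ := hcol (j + 1 + 1)
  have h₄ := hrow 0 j
  have h₅ := hrow 1 j
  have h₆ := hrow 0 (j + 1)
  have h₇ := hrow 1 (j + 1)
  have h₈ := hdom 0 j
  have h₉ := hdom 1 j
  have h₁₀ := hdom 0 (j + 1)
  have h₁₁ := hdom 1 (j + 1)
  simp only [columnStates, ColumnState.Step, add_sub_cancel_right]
  grind

theorem selectedVertices_columnStates {n : ℕ} [NeZero n] {s : Finset (Fin 2 × Fin n)}
    (hs : ∀ i, ¬ ((0, i) ∈ s ∧ (1, i) ∈ s)) : selectedVertices (columnStates s) = s := by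
  ext ⟨r, i⟩
  have h := hs i
  rw [mem_selectedVertices, columnStates]
  fin_cases r <;> grind

theorem columnStates_selectedVertices {n : ℕ} [NeZero n] {f : Fin n → ColumnState}
    (hf : ∀ i, (f i).Step (f (i + 1))) : columnStates (selectedVertices f) = f := by
  ext1 i
  have h := hf (i - 1)
  rw [sub_add_cancel] at h
  simp only [columnStates, mem_selectedVertices]
  generalize f (i - 1) = a at *
  generalize f i = b at *
  revert a b
  decide

open Polynomial in
theorem sum_misFinset_fatCylinder_two (n : ℕ) :
    ∑ M ∈ misFinset (fatCylinder 2 (n + 3)), (X : ℤ[X]) ^ M.card =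
      (columnTransfer ^ (n + 3)).trace := by
  classical
  rw [← sum_cycle_prod_eq_trace_pow]
  have hprod (f : Fin (n + 3) → ColumnState) :
      ∏ i, columnTransfer (f i) (f (i + 1)) =
        if ∀ i, (f i).Step (f (i + 1)) then X ^ (selectedVertices f).card else 0 := by
    simp only [columnTransfer]
    rw [Finset.prod_ite_zero, Finset.prod_ite]
    simp [card_selectedVertices]
  simp only [hprod, ← Finset.sum_filter]
  refine Finset.sum_nbij' columnStates selectedVertices (fun s hs => ?_) (fun f hf => ?_)
    (fun s hs => ?_) (fun f hf => ?_) (fun s hs => ?_)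
  · exact Finset.mem_filter.2 ⟨Finset.mem_univ _, step_columnStates (by simpa [misFinset] using hs)⟩
  · simpa [misFinset] using isMaxIndep_selectedVertices (Finset.mem_filter.1 hf).2
  · have hs : IsMaxIndep (fatCylinder 2 (n + 3)) s := by simpa [misFinset] using hs
    exact selectedVertices_columnStates ((isMaxIndep_fatCylinder_two_iff n s).1 hs).1
  · exact columnStates_selectedVertices (Finset.mem_filter.1 hf).2
  · have hs : IsMaxIndep (fatCylinder 2 (n + 3)) s := by simpa [misFinset] using hs
    rw [selectedVertices_columnStates ((isMaxIndep_fatCylinder_two_iff n s).1 hs).1]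

open Polynomial in
theorem columnTransfer_pow_four :
    columnTransfer ^ 4 =
      (X ^ 2 : ℤ[X]) • (columnTransfer ^ 2 + (columnTransfer + columnTransfer) + 1) := by
  rw [show columnTransfer ^ 4 = columnTransfer ^ 2 * columnTransfer ^ 2 by rw [← pow_add], sq]
  refine Matrix.ext fun s t => ?_
  obtain ⟨a, p⟩ := s
  obtain ⟨b, q⟩ := t
  fin_cases a <;> fin_cases b <;> cases p <;> cases q <;>
    simp [columnTransfer, ColumnState.Step, Matrix.mul_apply, Fintype.sum_prod_type] <;>
    ring

open Polynomial in
theorem trace_columnTransfer_pow_add_four (n : ℕ) :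
    (columnTransfer ^ (n + 4)).trace = X ^ 2 * ((columnTransfer ^ (n + 2)).trace +
      2 * (columnTransfer ^ (n + 1)).trace + (columnTransfer ^ n).trace) := by
  rw [pow_add, columnTransfer_pow_four, Matrix.mul_smul, Matrix.trace_smul, smul_eq_mul]
  simp only [mul_add, Matrix.trace_add, pow_add, pow_one, mul_one]
  ring

open Polynomial in
theorem trace_columnTransfer_pow_two : (columnTransfer ^ 2).trace = 2 * X ^ 2 := by
  simp [columnTransfer, ColumnState.Step, Matrix.mul_apply, Fintype.sum_prod_type, Matrix.trace, sq]
  ring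

open Polynomial in
theorem trace_columnTransfer_pow_three : (columnTransfer ^ 3).trace = 6 * X ^ 2 := by
  simp [columnTransfer, ColumnState.Step, Matrix.mul_apply, Fintype.sum_prod_type, Matrix.trace,
    pow_succ]
  ring

open Polynomial in
theorem trace_columnTransfer : columnTransfer.trace = 0 := by
  simp [columnTransfer, ColumnState.Step, Fintype.sum_prod_type, Matrix.trace]

/-- The sum of the `n`-th powers of the two primitive cube roots of unity. -/
def cubeRootPowerSum (n : ℕ) : ℤ := if n % 3 = 0 then 2 else -1

/-- The three-periodic sequence `1, -1, 0, …`. -/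
def cubeRootCorrection (n : ℕ) : ℤ := if n % 3 = 0 then 1 else if n % 3 = 1 then -1 else 0

theorem cubeRootPowerSum_add_four (n : ℕ) : cubeRootPowerSum (n + 4) =
    cubeRootPowerSum (n + 2) + 2 * cubeRootPowerSum (n + 1) + cubeRootPowerSum n := by
  unfold cubeRootPowerSum
  grind

theorem cubeRootCorrection_add_four (n : ℕ) : (n + 4) * cubeRootCorrection (n + 4) =
    2 * cubeRootPowerSum (n + 4) + (n + 2) * cubeRootCorrection (n + 2) +
      2 * ((n + 1) * cubeRootCorrection (n + 1)) + n * cubeRootCorrection n := by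
  have h : n % 3 = 0 ∨ n % 3 = 1 ∨ n % 3 = 2 := by lia
  rcases h with h | h | h <;>
    simp [cubeRootCorrection, cubeRootPowerSum, Nat.add_mod, h] <;> ring

open Polynomial goldenRatio in
theorem eval_trace_columnTransfer_pow : ∀ n : ℕ,
    (((columnTransfer ^ n).trace.eval 1 : ℤ) : ℝ) = φ ^ n + ψ ^ n + cubeRootPowerSum n
  | 0 => by norm_num [cubeRootPowerSum, Matrix.trace_one]
  | 1 => by
    simp [trace_columnTransfer, cubeRootPowerSum, Real.goldenRatio_add_goldenConj]
  | 2 => by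
    rw [trace_columnTransfer_pow_two, Real.goldenRatio_sq, Real.goldenConj_sq]
    norm_num [cubeRootPowerSum]
    linear_combination -Real.goldenRatio_add_goldenConj
  | 3 => by
    rw [trace_columnTransfer_pow_three, pow_succ φ, pow_succ ψ, Real.goldenRatio_sq,
      Real.goldenConj_sq]
    norm_num [cubeRootPowerSum]
    linear_combination -Real.goldenRatio_sq - Real.goldenConj_sq -
      2 * Real.goldenRatio_add_goldenConj
  | n + 4 => by
    have h := cubeRootPowerSum_add_four n
    rify at h
    rw [trace_columnTransfer_pow_add_four]
    simp only [eval_mul, eval_add, eval_pow, eval_X, eval_ofNat, one_pow, one_mul]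
    push_cast
    rw [eval_trace_columnTransfer_pow n, eval_trace_columnTransfer_pow (n + 1),
      eval_trace_columnTransfer_pow (n + 2), h]
    linear_combination -φ ^ n * (φ ^ 2 + φ + 1) * Real.goldenRatio_sq -
      ψ ^ n * (ψ ^ 2 + ψ + 1) * Real.goldenConj_sq

open Polynomial goldenRatio in
theorem eval_derivative_trace_columnTransfer_pow : ∀ n : ℕ,
    √5 * ((derivative (columnTransfer ^ n).trace).eval 1 : ℤ) =
      n * (φ ^ (n + 1) - ψ ^ (n + 1) + √5 * cubeRootCorrection n)
  | 0 => by simp [Matrix.trace_one]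
  | 1 => by
    simp [trace_columnTransfer, cubeRootCorrection, Real.goldenRatio_sq, Real.goldenConj_sq,
      ← Real.goldenRatio_sub_goldenConj]
  | 2 => by
    rw [trace_columnTransfer_pow_two, pow_succ φ, pow_succ ψ, Real.goldenRatio_sq,
      Real.goldenConj_sq, ← Real.goldenRatio_sub_goldenConj]
    norm_num [cubeRootCorrection]
    linear_combination -2 * Real.goldenRatio_sq + 2 * Real.goldenConj_sq
  | 3 => by
    rw [trace_columnTransfer_pow_three, show 3 + 1 = 2 * 2 from rfl, pow_mul, pow_mul ψ,
      Real.goldenRatio_sq, Real.goldenConj_sq, ← Real.goldenRatio_sub_goldenConj]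
    norm_num [cubeRootCorrection]
    linear_combination -3 * Real.goldenRatio_sq + 3 * Real.goldenConj_sq
  | n + 4 => by
    have h := cubeRootCorrection_add_four n
    have hc := eval_trace_columnTransfer_pow (n + 4)
    have h₀ := eval_derivative_trace_columnTransfer_pow n
    have h₁ := eval_derivative_trace_columnTransfer_pow (n + 1)
    have h₂ := eval_derivative_trace_columnTransfer_pow (n + 2)
    have hφ : √5 = 2 * φ - 1 := by
      linear_combination -Real.goldenRatio_sub_goldenConj - Real.goldenRatio_add_goldenConj
    have hψ : √5 = 1 - 2 * ψ := by
      linear_combination -Real.goldenRatio_sub_goldenConj + Real.goldenRatio_add_goldenConj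
    rify at h
    rw [trace_columnTransfer_pow_add_four] at hc ⊢
    simp only [eval_mul, eval_add, eval_pow, eval_X, eval_ofNat, one_pow, one_mul,
      derivative_mul, derivative_add, derivative_X_pow, derivative_ofNat, zero_mul, zero_add,
      map_natCast, eval_natCast, Nat.add_one_sub_one, mul_one] at hc ⊢
    push_cast at hc h₁ h₂ ⊢
    linear_combination h₀ + 2 * h₁ + h₂ + 2 * √5 * hc - √5 * h +
      2 * φ ^ (n + 4) * hφ + 2 * ψ ^ (n + 4) * hψ -
      φ ^ (n + 1) * (n * (φ ^ 2 + φ + 1) + 2 * φ) * Real.goldenRatio_sq +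
      ψ ^ (n + 1) * (n * (ψ ^ 2 + ψ + 1) + 2 * ψ) * Real.goldenConj_sq

open goldenRatio in
theorem card_misFinset_fatCylinder_two (n : ℕ) :
    ((misFinset (fatCylinder 2 (n + 3))).card : ℝ) =
      φ ^ (n + 3) + ψ ^ (n + 3) + cubeRootPowerSum (n + 3) := by
  rw [← eval_trace_columnTransfer_pow, ← sum_misFinset_fatCylinder_two]
  simp [Polynomial.eval_finsetSum]

open goldenRatio in
theorem sum_card_misFinset_fatCylinder_two (n : ℕ) :
    √5 * ∑ M ∈ misFinset (fatCylinder 2 (n + 3)), (M.card : ℝ) =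
      (n + 3 : ℕ) * (φ ^ (n + 3 + 1) - ψ ^ (n + 3 + 1) + √5 * cubeRootCorrection (n + 3)) := by
  rw [← eval_derivative_trace_columnTransfer_pow, ← sum_misFinset_fatCylinder_two]
  simp [Polynomial.eval_finsetSum, Polynomial.derivative_X_pow]

open goldenRatio in
theorem abs_avgMIS_fatCylinder_two_sub_le {n : ℕ} (hn : 4 ≤ φ ^ (n + 3)) :
    |avgMIS (fatCylinder 2 (n + 3)) - φ / √5 * (n + 3 : ℕ)| ≤
      16 * ((n + 3 : ℕ) / φ ^ (n + 3)) := by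
  have hcard := card_misFinset_fatCylinder_two n
  have hsum := sum_card_misFinset_fatCylinder_two n
  rw [avgMIS]
  generalize ∑ M ∈ misFinset (fatCylinder 2 (n + 3)), (M.card : ℝ) = S at *
  generalize ((misFinset (fatCylinder 2 (n + 3))).card : ℝ) = c at *
  generalize n + 3 = m at *
  have hu : |(cubeRootPowerSum m : ℝ)| ≤ 2 := by
    norm_cast
    unfold cubeRootPowerSum
    split <;> simp
  have ht : |(cubeRootCorrection m : ℝ)| ≤ 1 := by
    norm_cast
    unfold cubeRootCorrection
    split_ifs <;> simp
  have hψ : |ψ ^ m| ≤ 1 := by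
    rw [abs_pow]
    exact pow_le_one₀ (abs_nonneg _)
      (abs_le.2 ⟨Real.neg_one_lt_goldenConj.le, Real.goldenConj_neg.le.trans zero_le_one⟩)
  have h5 : 2 ≤ √5 := Real.le_sqrt_of_sq_le (by norm_num)
  have h5' : √5 ≤ 3 := Real.sqrt_le_iff.2 (by norm_num)
  have hc : φ ^ m / 4 ≤ c := by
    rw [hcard]
    linarith [(abs_le.1 hu).1, (abs_le.1 hψ).1]
  have hc0 : 0 < c := by linarith
  have hmain : S / c - φ / √5 * m =
      m * (-ψ ^ m + √5 * cubeRootCorrection m - φ * cubeRootPowerSum m) / (√5 * c) := by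
    rw [eq_div_iff (by positivity)]
    have h₁ : S / c * c = S := div_mul_cancel₀ S hc0.ne'
    have h₂ : φ / √5 * √5 = φ := div_mul_cancel₀ φ (by positivity)
    generalize φ / √5 = q at *
    linear_combination √5 * h₁ - m * c * h₂ + hsum - m * φ * hcard -
      m * ψ ^ m * Real.goldenRatio_add_goldenConj
  have hnum : |-ψ ^ m + √5 * cubeRootCorrection m - φ * cubeRootPowerSum m| ≤ 8 := by
    have h₁ : |√5 * cubeRootCorrection m| ≤ 3 * 1 := by
      rw [abs_mul, abs_of_pos (by positivity)]
      gcongr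
    have h₂ : |φ * cubeRootPowerSum m| ≤ 2 * 2 := by
      rw [abs_mul, abs_of_pos Real.goldenRatio_pos]
      gcongr
      exact Real.goldenRatio_lt_two.le
    rw [abs_le] at *
    constructor <;> linarith
  rw [hmain, abs_div, abs_mul, Nat.abs_cast, abs_of_pos (show 0 < √5 * c by positivity)]
  calc m * |-ψ ^ m + √5 * cubeRootCorrection m - φ * cubeRootPowerSum m| / (√5 * c)
      ≤ m * 8 / (2 * (φ ^ m / 4)) := by gcongr
    _ = 16 * (m / φ ^ m) := by ring

theorem avg_mis_fat_cylinder_two_by_n :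
    Filter.Tendsto
      (fun n : ℕ => avgMIS (fatCylinder 2 n) - ((1 + Real.sqrt 5) / 2 / Real.sqrt 5) * n)
      Filter.atTop (nhds 0) := by
  rw [← Filter.tendsto_add_atTop_iff_nat 3]
  have hlim := (tendsto_pow_const_div_const_pow_of_one_lt 1 Real.one_lt_goldenRatio).const_mul 16
  rw [mul_zero, ← Filter.tendsto_add_atTop_iff_nat 3] at hlim
  have hpow := (Filter.tendsto_add_atTop_iff_nat 3).2
    (tendsto_pow_atTop_atTop_of_one_lt Real.one_lt_goldenRatio)
  refine squeeze_zero_norm' ?_ hlim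
  filter_upwards [hpow.eventually_ge_atTop 4] with n hn
  rw [pow_one]
  exact abs_avgMIS_fatCylinder_two_sub_le hn
end
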